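/- Let m > n and let C ≤ Mat_{n×m}(F_q) be an MRD code with minimum rank distance d and dimension k = m(n−d+1). Then for every integer r ≥ 1, the r-th higher rank-weight enumerator is W_C^(r)(x,y) = Σ_{w=d}^{n} [n choose w]_q ( Σ_{u=d}^{w} (−1)^{w−u} q^{binom(w−u,2)} [w choose u]_q [k − m(n−u) choose r]_q ) x^{n−w} y^{w}. -/

import Mathlib

set_option linter.unusedSectionVars false

open Finset Matrix

variable {F : Type} [Field F] [Fintype F]

/-- The column space of a matrix: the span of its columns. -/
noncomputable def colspace {n m : ℕ} (M : Matrix (Fin n) (Fin m) F) :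
    Submodule F (Fin n → F) :=
  Submodule.span F (Set.range Mᵀ)

lemma col_mem_colspace {n m : ℕ} (M : Matrix (Fin n) (Fin m) F) (j : Fin m) :
    Mᵀ j ∈ colspace M :=
  Submodule.subset_span ⟨j, rfl⟩

/-- `codeSub C J = C(J) = { M ∈ C : colspace M ≤ J }`, as a submodule. -/
noncomputable def codeSub {n m : ℕ} (C : Submodule F (Matrix (Fin n) (Fin m) F))
    (J : Submodule F (Fin n → F)) : Submodule F (Matrix (Fin n) (Fin m) F) where
  carrier := {M | M ∈ C ∧ colspace M ≤ J}
  zero_mem' := ⟨C.zero_mem, by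
    rw [colspace]
    refine Submodule.span_le.2 ?_
    rintro _ ⟨j, rfl⟩
    have h : (0 : Matrix (Fin n) (Fin m) F)ᵀ j = 0 := by
      funext i; simp
    rw [h]; exact J.zero_mem⟩
  add_mem' := by
    rintro A B ⟨hA, hA'⟩ ⟨hB, hB'⟩
    refine ⟨C.add_mem hA hB, ?_⟩
    rw [colspace]
    refine Submodule.span_le.2 ?_
    rintro _ ⟨j, rfl⟩
    have h : (A + B)ᵀ j = Aᵀ j + Bᵀ j := by
      funext i; simp [Matrix.transpose_apply]
    rw [h]
    exact J.add_mem (hA' (col_mem_colspace A j)) (hB' (col_mem_colspace B j))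
  smul_mem' := by
    rintro c A ⟨hA, hA'⟩
    refine ⟨C.smul_mem c hA, ?_⟩
    rw [colspace]
    refine Submodule.span_le.2 ?_
    rintro _ ⟨j, rfl⟩
    have h : (c • A)ᵀ j = c • (Aᵀ j) := by
      funext i; simp [Matrix.transpose_apply]
    rw [h]
    exact J.smul_mem c (hA' (col_mem_colspace A j))

/-- Higher rank-support of a subcode: the sum of the column spaces of its members. -/
noncomputable def Supp {n m : ℕ} (D : Submodule F (Matrix (Fin n) (Fin m) F)) :
    Submodule F (Fin n → F) :=
  ⨆ M ∈ (D : Set (Matrix (Fin n) (Fin m) F)), colspace M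

/-- The linear functional `x ↦ ∑ i, x i * y i` (standard inner product with `y`). -/
noncomputable def dotForm {n : ℕ} (y : Fin n → F) : (Fin n → F) →ₗ[F] F where
  toFun x := ∑ i, x i * y i
  map_add' a b := by simp [add_mul, Finset.sum_add_distrib]
  map_smul' c a := by simp [Finset.mul_sum, mul_assoc]

/-- Orthogonal complement w.r.t. the standard inner product on `F^n`. -/
noncomputable def perp {n : ℕ} (J : Submodule F (Fin n → F)) : Submodule F (Fin n → F) :=
  ⨅ y ∈ (J : Set (Fin n → F)), LinearMap.ker (dotForm y)

/-- The linear functional `N ↦ Tr (M Nᵀ)`. -/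
noncomputable def traceForm {n m : ℕ} (M : Matrix (Fin n) (Fin m) F) :
    Matrix (Fin n) (Fin m) F →ₗ[F] F where
  toFun N := Matrix.trace (M * Nᵀ)
  map_add' A B := by simp [Matrix.transpose_add, Matrix.mul_add]
  map_smul' c A := by simp [Matrix.transpose_smul, Matrix.mul_smul]

/-- The trace dual code. -/
noncomputable def dualCode {n m : ℕ} (C : Submodule F (Matrix (Fin n) (Fin m) F)) :
    Submodule F (Matrix (Fin n) (Fin m) F) :=
  ⨅ M ∈ (C : Set (Matrix (Fin n) (Fin m) F)), LinearMap.ker (traceForm M)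

/-- Gaussian binomial coefficient `[a choose r]_q` as a rational number. -/
noncomputable def gb (q : ℚ) (a r : ℕ) : ℚ :=
  ∏ i ∈ Finset.range r, (q ^ a - q ^ i) / (q ^ r - q ^ i)

/-- Gaussian binomial with integer upper argument:
`[a choose b]_q = ∏_{i=0}^{b-1} (q^{a-i}-1)/(q^{b-i}-1)`. -/
noncomputable def gbZ (q : ℚ) (a : ℤ) (b : ℕ) : ℚ :=
  ∏ i ∈ Finset.range b, (q ^ (a - (i : ℤ)) - 1) / (q ^ ((b : ℤ) - (i : ℤ)) - 1)


lemma gb_zero_right (q : ℚ) (a : ℕ) : gb q a 0 = 1 := by simp [gb]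

lemma gb_eq_zero_of_lt (q : ℚ) {a r : ℕ} (h : a < r) : gb q a r = 0 :=
  Finset.prod_eq_zero (Finset.mem_range.2 h) (by simp)

/-- The recursion between consecutive lower arguments. -/
lemma gb_succ_right_mul {q : ℚ} (hq : 1 < q) (a r : ℕ) :
    gb q a (r + 1) * (q ^ (r + 1) - 1) = gb q a r * (q ^ (a - r) - 1) := by
  rcases lt_or_ge a r with h | h
  · rw [gb_eq_zero_of_lt q h, gb_eq_zero_of_lt q (h.trans (Nat.lt_succ_self r))]; simp
  have hq0 : q ≠ 0 := by positivity
  have hden : ∀ k i : ℕ, i < k → q ^ k - q ^ i ≠ 0 := fun k i hik =>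
    sub_ne_zero.2 (pow_lt_pow_right₀ hq hik).ne'
  have hP : ∏ i ∈ range r, (q ^ r - q ^ i) ≠ 0 :=
    Finset.prod_ne_zero_iff.2 fun i hi => hden r i (Finset.mem_range.1 hi)
  have hD : ∏ i ∈ range (r + 1), (q ^ (r + 1) - q ^ i)
      = q ^ r * (∏ i ∈ range r, (q ^ r - q ^ i)) * (q ^ (r + 1) - 1) := by
    rw [Finset.prod_range_succ']
    have : ∀ i ∈ range r, q ^ (r + 1) - q ^ (i + 1) = q * (q ^ r - q ^ i) := by
      intros; ring
    rw [Finset.prod_congr rfl this, Finset.prod_mul_distrib]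
    simp
  have hr1 : q ^ (r + 1) - 1 ≠ 0 := by simpa using hden (r + 1) 0 (Nat.succ_pos r)
  obtain ⟨c, rfl⟩ := Nat.exists_eq_add_of_le h
  unfold gb
  rw [Finset.prod_div_distrib, Finset.prod_div_distrib, hD, Finset.prod_range_succ,
    Nat.add_sub_cancel_left]
  field_simp
  ring

lemma gb_self {q : ℚ} (hq : 1 < q) (a : ℕ) : gb q a a = 1 :=
  Finset.prod_eq_one fun _ hi =>
    div_self (sub_ne_zero.2 (pow_lt_pow_right₀ hq (Finset.mem_range.1 hi)).ne')

lemma gb_succ_succ_mul {q : ℚ} (hq : 1 < q) (a r : ℕ) :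
    gb q (a + 1) (r + 1) * (q ^ (r + 1) - 1) = gb q a r * (q ^ (a + 1) - 1) := by
  induction r with
  | zero => simpa [gb_zero_right] using gb_succ_right_mul hq (a + 1) 0
  | succ r ih =>
    have h1 := gb_succ_right_mul hq (a + 1) (r + 1)
    have h2 := gb_succ_right_mul hq a r
    have hr1 : q ^ (r + 1) - 1 ≠ 0 := sub_ne_zero.2 (one_lt_pow₀ hq (Nat.succ_ne_zero r)).ne'
    rw [Nat.add_sub_add_right] at h1
    apply mul_right_cancel₀ hr1
    rw [h1]
    linear_combination (q ^ (a - r) - 1) * ih - (q ^ (a + 1) - 1) * h2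

/-- The Pascal recursion of Gaussian binomials. -/
lemma gb_succ_succ {q : ℚ} (hq : 1 < q) {a r : ℕ} (h : r ≤ a) :
    gb q (a + 1) (r + 1) = gb q a (r + 1) + q ^ (a - r) * gb q a r := by
  have hr1 : q ^ (r + 1) - 1 ≠ 0 := sub_ne_zero.2 (one_lt_pow₀ hq (Nat.succ_ne_zero r)).ne'
  apply mul_right_cancel₀ hr1
  have e : q ^ (a + 1) = q ^ (a - r) * q ^ (r + 1) := by
    rw [← pow_add]; congr 1; omega
  rw [gb_succ_succ_mul hq, add_mul, gb_succ_right_mul hq, e]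
  ring

/-- Trinomial revision for Gaussian binomials. -/
lemma gb_mul_gb {q : ℚ} (hq : 1 < q) (w v j : ℕ) :
    gb q (w + v) (j + v) * gb q (j + v) v = gb q (w + v) v * gb q w j := by
  induction v with
  | zero => simp [gb_zero_right]
  | succ v ih =>
    have hv : q ^ (v + 1) - 1 ≠ 0 := sub_ne_zero.2 (one_lt_pow₀ hq (Nat.succ_ne_zero v)).ne'
    have hj : q ^ (j + v + 1) - 1 ≠ 0 :=
      sub_ne_zero.2 (one_lt_pow₀ hq (Nat.succ_ne_zero _)).ne'
    have h1 := gb_succ_succ_mul hq (w + v) (j + v)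
    have h2 := gb_succ_succ_mul hq (j + v) v
    have h3 := gb_succ_succ_mul hq (w + v) v
    apply mul_right_cancel₀ hv
    apply mul_right_cancel₀ hj
    simp only [← add_assoc]
    linear_combination (gb q (j + v + 1) (v + 1) * (q ^ (v + 1) - 1)) * h1
      + gb q (w + v) (j + v) * (q ^ (w + v + 1) - 1) * h2
      - gb q w j * (q ^ (j + v + 1) - 1) * h3
      + (q ^ (w + v + 1) - 1) * (q ^ (j + v + 1) - 1) * ih

/-- The alternating sum of Gaussian binomials vanishes. -/
lemma sum_alternating_gb {q : ℚ} (hq : 1 < q) (a : ℕ) :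
    ∑ j ∈ range (a + 1), (-1 : ℚ) ^ j * q ^ (j.choose 2) * gb q a j = if a = 0 then 1 else 0 := by
  induction a with
  | zero => simp [gb_zero_right]
  | succ a ih =>
    have key : ∑ j ∈ range (a + 2), (-1 : ℚ) ^ j * q ^ (j.choose 2) * gb q (a + 1) j
        = (1 - q ^ a) * ∑ j ∈ range (a + 1), (-1 : ℚ) ^ j * q ^ (j.choose 2) * gb q a j := by
      have e : ∀ j ∈ range (a + 1),
          (-1 : ℚ) ^ (j + 1) * q ^ ((j + 1).choose 2) * gb q (a + 1) (j + 1)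
          = (-1 : ℚ) ^ (j + 1) * q ^ ((j + 1).choose 2) * gb q a (j + 1)
            - q ^ a * ((-1 : ℚ) ^ j * q ^ (j.choose 2) * gb q a j) := by
        intro j hj
        have hja : j ≤ a := Nat.lt_succ_iff.1 (Finset.mem_range.1 hj)
        have e1 : (j + 1).choose 2 = j + j.choose 2 := by
          rw [Nat.choose_succ_succ' j 1, Nat.choose_one_right]
        have e2 : q ^ a = q ^ (a - j) * q ^ j := by rw [← pow_add]; congr 1; omega
        rw [gb_succ_succ hq hja, e1, e2]
        ring
      rw [Finset.sum_range_succ', Finset.sum_congr rfl e, Finset.sum_sub_distrib,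
        ← Finset.mul_sum, sub_mul, one_mul]
      have s : ∑ j ∈ range (a + 2), (-1 : ℚ) ^ j * q ^ (j.choose 2) * gb q a j
          = ∑ j ∈ range (a + 1), (-1 : ℚ) ^ j * q ^ (j.choose 2) * gb q a j := by
        rw [Finset.sum_range_succ, gb_eq_zero_of_lt q (Nat.lt_succ_self a)]; simp
      rw [Finset.sum_range_succ'] at s
      rw [← s]
      simp [gb_zero_right]
      ring
    rw [key, ih]
    rcases Nat.eq_zero_or_pos a with rfl | h
    · simp
    · simp [h.ne']

/-- Gaussian inversion. -/
lemma sum_gb_mul_inversion {q : ℚ} (hq : 1 < q) (N : ℕ → ℚ) (w : ℕ) :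
    ∑ u ∈ range (w + 1), gb q w u * ∑ v ∈ range (u + 1),
      (-1 : ℚ) ^ (u - v) * q ^ ((u - v).choose 2) * gb q u v * N v = N w := by
  have hext : ∀ u ∈ range (w + 1), gb q w u * ∑ v ∈ range (u + 1),
      (-1 : ℚ) ^ (u - v) * q ^ ((u - v).choose 2) * gb q u v * N v
      = ∑ v ∈ range (w + 1),
        gb q w u * ((-1 : ℚ) ^ (u - v) * q ^ ((u - v).choose 2) * gb q u v * N v) := by
    intro u hu
    rw [Finset.mul_sum]
    refine Finset.sum_subset (Finset.range_subset_range.2 (Finset.mem_range.1 hu)) ?_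
    intro v _ hv
    rw [gb_eq_zero_of_lt q (a := u) (r := v) (by simpa using hv)]
    simp
  have hcol : ∀ v ∈ range (w + 1), ∑ u ∈ range (w + 1),
      gb q w u * ((-1 : ℚ) ^ (u - v) * q ^ ((u - v).choose 2) * gb q u v * N v)
      = if w = v then N v else 0 := by
    intro v hv
    obtain ⟨c, rfl⟩ := Nat.exists_eq_add_of_le' (Nat.lt_succ_iff.1 (Finset.mem_range.1 hv))
    rw [show c + v + 1 = v + (c + 1) by ring, Finset.sum_range_add, Finset.sum_eq_zero, zero_add]
    · have e : ∀ j ∈ range (c + 1), gb q (c + v) (v + j) *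
          ((-1 : ℚ) ^ (v + j - v) * q ^ ((v + j - v).choose 2) * gb q (v + j) v * N v)
          = gb q (c + v) v * N v * ((-1 : ℚ) ^ j * q ^ (j.choose 2) * gb q c j) := by
        intro j _
        rw [Nat.add_sub_cancel_left, add_comm v j]
        linear_combination (-1 : ℚ) ^ j * q ^ (j.choose 2) * N v * gb_mul_gb hq c v j
      rw [Finset.sum_congr rfl e, ← Finset.mul_sum, sum_alternating_gb hq]
      rcases Nat.eq_zero_or_pos c with rfl | hc
      · simp [gb_self hq]
      · simp [hc.ne']
    · intro u hu
      rw [gb_eq_zero_of_lt q (Finset.mem_range.1 hu)]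
      simp
  rw [Finset.sum_congr rfl hext, Finset.sum_comm, Finset.sum_congr rfl hcol]
  simp

lemma gbZ_natCast (q : ℚ) (hq : 1 < q) (a b : ℕ) : gbZ q (a : ℤ) b = gb q a b := by
  have hq0 : q ≠ 0 := by positivity
  refine Finset.prod_congr rfl fun i _ => ?_
  rw [zpow_sub₀ hq0, zpow_sub₀ hq0]
  simp only [zpow_natCast]
  have : q ^ i ≠ 0 := pow_ne_zero _ hq0
  rw [div_sub_one this, div_sub_one this, div_div_div_cancel_right₀ this]

lemma card_submodule_finrank_eq {V : Type} [AddCommGroup V] [Module F V] [Finite V] (r : ℕ) :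
    (Nat.card {D : Submodule F V // Module.finrank F D = r} : ℚ)
      = gb (Fintype.card F) (Module.finrank F V) r := by
  have hq : (1 : ℚ) < Fintype.card F := by exact_mod_cast Fintype.one_lt_card
  rcases lt_or_ge (Module.finrank F V) r with h | h
  · rw [gb_eq_zero_of_lt _ h]
    have : IsEmpty {D : Submodule F V // Module.finrank F D = r} :=
      ⟨fun D => absurd D.2 ((Submodule.finrank_le D.1).trans_lt h).ne⟩
    simp
  let f : (Σ D : {D : Submodule F V // Module.finrank F D = r},
      {t : Fin r → D.1 // LinearIndependent F t}) → {s : Fin r → V // LinearIndependent F s} :=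
    fun p => ⟨fun i => (p.2.1 i : V), p.2.2.map' p.1.1.subtype (Submodule.ker_subtype _)⟩
  have hspan : ∀ p, Submodule.span F (Set.range (f p).1) = p.1.1 := by
    rintro ⟨⟨D, hD⟩, ⟨t, ht⟩⟩
    apply Submodule.eq_of_le_of_finrank_eq
    · rw [Submodule.span_le]; rintro _ ⟨i, rfl⟩; exact (t i).2
    · rw [finrank_span_eq_card (f _).2, Fintype.card_fin, hD]
  have hf : Function.Bijective f := by
    constructor
    · intro p p' hpp
      have h1 : p.1 = p'.1 := Subtype.ext (by rw [← hspan p, ← hspan p', hpp])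
      obtain ⟨D, t⟩ := p
      obtain ⟨D', t'⟩ := p'
      obtain rfl : D = D' := h1
      congr 1
      ext i
      exact congrFun (congrArg Subtype.val hpp) i
    · rintro ⟨s, hs⟩
      refine ⟨⟨⟨Submodule.span F (Set.range s), ?_⟩,
        ⟨fun i => ⟨s i, Submodule.subset_span ⟨i, rfl⟩⟩, linearIndependent_span hs⟩⟩, rfl⟩
      rw [finrank_span_eq_card hs, Fintype.card_fin]
  have hcard := Nat.card_congr (Equiv.ofBijective f hf)
  rw [card_linearIndependent h] at hcard
  have : Fintype {D : Submodule F V // Module.finrank F D = r} := Fintype.ofFinite _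
  rw [Nat.card_sigma] at hcard
  have hfib : ∀ D : {D : Submodule F V // Module.finrank F D = r},
      Nat.card {t : Fin r → D.1 // LinearIndependent F t}
        = ∏ i : Fin r, (Fintype.card F ^ r - Fintype.card F ^ i.val) := by
    rintro ⟨D, hD⟩
    rw [card_linearIndependent hD.ge, hD]
  simp only [hfib, Finset.sum_const, Finset.card_univ, smul_eq_mul] at hcard
  rw [Nat.card_eq_fintype_card]
  have hcast : ∀ k : ℕ, r ≤ k →
      ((∏ i : Fin r, (Fintype.card F ^ k - Fintype.card F ^ i.val) : ℕ) : ℚ)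
        = ∏ i ∈ range r, ((Fintype.card F : ℚ) ^ k - (Fintype.card F : ℚ) ^ i) := by
    intro k hk
    rw [Finset.prod_range, Nat.cast_prod]
    refine Finset.prod_congr rfl fun i _ => ?_
    rw [Nat.cast_sub (Nat.pow_le_pow_right Fintype.card_pos (i.2.le.trans hk))]
    simp
  have hcQ := congrArg (Nat.cast (R := ℚ)) hcard
  rw [Nat.cast_mul, hcast _ le_rfl, hcast _ h] at hcQ
  unfold gb
  rw [Finset.prod_div_distrib, eq_div_iff, hcQ]
  exact Finset.prod_ne_zero_iff.2 fun i hi =>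
    sub_ne_zero.2 (pow_lt_pow_right₀ hq (Finset.mem_range.1 hi)).ne'

lemma card_submodule_le_finrank_eq {V : Type} [AddCommGroup V] [Module F V] [Finite V]
    (W : Submodule F V) (r : ℕ) :
    (Nat.card {D : Submodule F V // D ≤ W ∧ Module.finrank F D = r} : ℚ)
      = gb (Fintype.card F) (Module.finrank F W) r := by
  rw [← card_submodule_finrank_eq]
  congr 1
  refine (Nat.card_congr ?_).symm
  refine (Equiv.subtypeEquiv (Submodule.mapIic W).toEquiv
    (q := fun D : {D // D ≤ W} => Module.finrank F D.1 = r) ?_).trans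
    (Equiv.subtypeSubtypeEquivSubtypeInter (fun D => D ≤ W) (fun D => Module.finrank F D = r))
  intro D
  have : Module.finrank F (D.map W.subtype) = Module.finrank F D :=
    Submodule.finrank_map_subtype_eq W D
  simpa using this.symm ▸ Iff.rfl

lemma mem_codeSub {n m : ℕ} {C : Submodule F (Matrix (Fin n) (Fin m) F)}
    {J : Submodule F (Fin n → F)} {M : Matrix (Fin n) (Fin m) F} :
    M ∈ codeSub C J ↔ M ∈ C ∧ colspace M ≤ J := Iff.rfl

lemma le_codeSub_iff {n m : ℕ} {C D : Submodule F (Matrix (Fin n) (Fin m) F)}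
    {J : Submodule F (Fin n → F)} : D ≤ codeSub C J ↔ D ≤ C ∧ Supp D ≤ J := by
  simp only [Supp, iSup_le_iff, SetLike.mem_coe]
  exact forall₂_and

lemma colspace_le_iff {n m : ℕ} {M : Matrix (Fin n) (Fin m) F} {J : Submodule F (Fin n → F)} :
    colspace M ≤ J ↔ ∀ j, Mᵀ j ∈ J := by
  exact Submodule.span_le.trans Set.range_subset_iff

lemma finrank_colspace {n m : ℕ} (M : Matrix (Fin n) (Fin m) F) :
    Module.finrank F (colspace M) = M.rank :=
  M.rank_eq_finrank_span_cols.symm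

lemma finrank_codeSub_top {n m : ℕ} (J : Submodule F (Fin n → F)) :
    Module.finrank F (codeSub (⊤ : Submodule F (Matrix (Fin n) (Fin m) F)) J)
      = m * Module.finrank F J := by
  let e : codeSub (⊤ : Submodule F (Matrix (Fin n) (Fin m) F)) J ≃ₗ[F] (Fin m → J) :=
    { toFun := fun M j => ⟨M.1ᵀ j, colspace_le_iff.1 M.2.2 j⟩
      map_add' := fun _ _ => rfl
      map_smul' := fun _ _ => rfl
      invFun := fun t => ⟨Matrix.of fun i j => (t j : Fin n → F) i,
        trivial, colspace_le_iff.2 fun j => (t j).2⟩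
      left_inv := fun _ => rfl
      right_inv := fun _ => rfl }
  rw [e.finrank_eq, Module.finrank_pi_fintype]
  simp

lemma exists_submodule_le_finrank_eq {V : Type} [AddCommGroup V] [Module F V] [Finite V]
    (W : Submodule F V) {k : ℕ} (hk : k ≤ Module.finrank F W) :
    ∃ U ≤ W, Module.finrank F U = k := by
  obtain ⟨t, ht⟩ := exists_linearIndependent_of_le_finrank hk
  refine ⟨(Submodule.span F (Set.range t)).map W.subtype, Submodule.map_subtype_le _ _, ?_⟩
  rw [Submodule.finrank_map_subtype_eq, finrank_span_eq_card ht, Fintype.card_fin]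

lemma codeSub_eq_bot {n m d : ℕ} {C : Submodule F (Matrix (Fin n) (Fin m) F)}
    (hd : ∀ M ∈ C, M ≠ 0 → d ≤ M.rank) {J : Submodule F (Fin n → F)}
    (hJ : Module.finrank F J < d) : codeSub C J = ⊥ := by
  rw [Submodule.eq_bot_iff]
  rintro M ⟨hM, hMJ⟩
  by_contra h0
  have h1 := hd M hM h0
  rw [← finrank_colspace] at h1
  have h2 := Submodule.finrank_mono hMJ
  omega

/-- Shortened subcodes of an MRD code have the dimension of a uniform `q`-polymatroid. -/
lemma finrank_codeSub_of_mrd {n m d : ℕ} {C : Submodule F (Matrix (Fin n) (Fin m) F)}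
    (hd0 : 0 < d) (hd : ∀ M ∈ C, M ≠ 0 → d ≤ M.rank)
    (hk : Module.finrank F C = m * (n - d + 1)) {J : Submodule F (Fin n → F)}
    (hJ : d ≤ Module.finrank F J) :
    Module.finrank F (codeSub C J) = m * (Module.finrank F J - d + 1) := by
  have hJn : Module.finrank F J ≤ n := by simpa using Submodule.finrank_le J
  have hT := finrank_codeSub_top (m := m) J
  apply le_antisymm
  · obtain ⟨U, hU, hUd⟩ := exists_submodule_le_finrank_eq J (k := d - 1) (by omega)
    have hTU := finrank_codeSub_top (m := m) U
    have hinf : codeSub C J ⊓ codeSub ⊤ U = ⊥ := by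
      rw [eq_bot_iff, ← codeSub_eq_bot hd (J := U) (by omega)]
      rintro M ⟨h1, h2⟩
      exact ⟨h1.1, h2.2⟩
    have hsup : codeSub C J ⊔ codeSub ⊤ U ≤ codeSub ⊤ J :=
      sup_le (fun M hM => ⟨trivial, hM.2⟩) fun M hM => ⟨trivial, hM.2.trans hU⟩
    have h1 := Submodule.finrank_sup_add_finrank_inf_eq (codeSub C J) (codeSub ⊤ U)
    have h2 := Submodule.finrank_mono hsup
    rw [hinf, finrank_bot] at h1
    have : Module.finrank F J = (Module.finrank F J - d + 1) + (d - 1) := by omega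
    rw [hT, this, mul_add] at h2
    rw [hTU, hUd] at h1
    omega
  · have hinf : C ⊓ codeSub ⊤ J = codeSub C J := by
      ext M; exact ⟨fun h => ⟨h.1, h.2.2⟩, fun h => ⟨h.1, trivial, h.2⟩⟩
    have h1 := Submodule.finrank_sup_add_finrank_inf_eq C (codeSub ⊤ J)
    have h2 := Submodule.finrank_le (C ⊔ codeSub ⊤ J)
    rw [Module.finrank_matrix] at h2
    simp only [Fintype.card_fin, Module.finrank_self, mul_one] at h2
    rw [hinf, hT, hk] at h1
    have e : m * (n - d + 1) + m * Module.finrank F J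
        = m * (Module.finrank F J - d + 1) + n * m := by
      rw [← mul_add, mul_comm n m, ← mul_add]; congr 1; omega
    omega

open Classical in
lemma sum_submodule_le_finrank {V : Type} [AddCommGroup V] [Module F V] [Finite V]
    [Fintype (Submodule F V)] (W : Submodule F V) (g : ℕ → ℚ) :
    ∑ U : Submodule F V with U ≤ W, g (Module.finrank F U)
      = ∑ w ∈ range (Module.finrank F W + 1),
          gb (Fintype.card F) (Module.finrank F W) w * g w := by
  rw [← Finset.sum_fiberwise_of_maps_to (t := range (Module.finrank F W + 1))
    (g := fun U : Submodule F V => Module.finrank F U)]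
  · refine Finset.sum_congr rfl fun w _ => ?_
    rw [Finset.sum_congr rfl (g := fun _ => g w) (by simp +contextual), Finset.sum_const,
      nsmul_eq_mul, ← card_submodule_le_finrank_eq, Finset.filter_filter,
      Nat.card_eq_fintype_card, Fintype.card_subtype]
  · intro U hU
    exact Finset.mem_range.2 (Nat.lt_succ_of_le (Submodule.finrank_mono (by simpa using hU)))

open Classical in
lemma eq_of_sum_le_eq {α : Type} [PartialOrder α] [Fintype α] {f g : α → ℚ}
    (h : ∀ a, ∑ b with b ≤ a, f b = ∑ b with b ≤ a, g b) : f = g := by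
  funext a
  induction a using WellFoundedLT.induction with
  | ind a ih =>
    have ha : a ∈ Finset.univ.filter (· ≤ a) := by simp
    have h1 := h a
    rw [← Finset.add_sum_erase _ _ ha, ← Finset.add_sum_erase _ _ ha] at h1
    have h2 : ∑ b ∈ (Finset.univ.filter (· ≤ a)).erase a, f b
        = ∑ b ∈ (Finset.univ.filter (· ≤ a)).erase a, g b := by
      refine Finset.sum_congr rfl fun b hb => ih b ?_
      simp only [Finset.mem_erase, Finset.mem_filter, Finset.mem_univ, true_and] at hb
      exact lt_of_le_of_ne hb.2 hb.1
    linarith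

open Classical in
/-- The number of subcodes with prescribed support, when the number of subcodes supported
below a space depends only on its dimension. -/
lemma card_subcode_supp_eq {n m r : ℕ} {C : Submodule F (Matrix (Fin n) (Fin m) F)}
    [Fintype (Submodule F (Fin n → F))] [Fintype (Submodule F (Matrix (Fin n) (Fin m) F))]
    {N : ℕ → ℚ}
    (hN : ∀ U : Submodule F (Fin n → F),
      gb (Fintype.card F) (Module.finrank F (codeSub C U)) r = N (Module.finrank F U))
    (W : Submodule F (Fin n → F)) :
    (#{D : Submodule F (Matrix (Fin n) (Fin m) F) |
        (D ≤ C ∧ Module.finrank F D = r) ∧ Supp D = W} : ℚ)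
      = ∑ v ∈ range (Module.finrank F W + 1), (-1 : ℚ) ^ (Module.finrank F W - v) *
          (Fintype.card F : ℚ) ^ ((Module.finrank F W - v).choose 2) *
          gb (Fintype.card F) (Module.finrank F W) v * N v := by
  have hq : (1 : ℚ) < Fintype.card F := by exact_mod_cast Fintype.one_lt_card
  refine congrFun (eq_of_sum_le_eq
    (f := fun W => (#{D : Submodule F (Matrix (Fin n) (Fin m) F) |
        (D ≤ C ∧ Module.finrank F D = r) ∧ Supp D = W} : ℚ))
    (g := fun W => ∑ v ∈ range (Module.finrank F W + 1), (-1 : ℚ) ^ (Module.finrank F W - v) *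
          (Fintype.card F : ℚ) ^ ((Module.finrank F W - v).choose 2) *
          gb (Fintype.card F) (Module.finrank F W) v * N v) fun W => ?_) W
  rw [sum_submodule_le_finrank W (fun u => ∑ v ∈ range (u + 1), (-1 : ℚ) ^ (u - v) *
    (Fintype.card F : ℚ) ^ ((u - v).choose 2) * gb (Fintype.card F) u v * N v),
    sum_gb_mul_inversion hq, ← hN, ← card_submodule_le_finrank_eq,
    Nat.card_eq_fintype_card, Fintype.card_subtype,
    Finset.card_eq_sum_card_fiberwise (f := Supp)
      (t := Finset.univ.filter (fun U : Submodule F (Fin n → F) => U ≤ W))]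
  · push_cast
    refine Finset.sum_congr rfl fun U hU => ?_
    have hUW : U ≤ W := by simpa using hU
    rw [Finset.filter_filter]
    congr 2
    ext D
    simp only [Finset.mem_filter, Finset.mem_univ, true_and, le_codeSub_iff]
    constructor
    · rintro ⟨⟨h1, h2⟩, rfl⟩
      exact ⟨⟨⟨h1, hUW⟩, h2⟩, rfl⟩
    · rintro ⟨⟨⟨h1, _⟩, h2⟩, h3⟩
      exact ⟨⟨h1, h2⟩, h3⟩
  · intro D hD
    have hD' : D ≤ codeSub C W ∧ Module.finrank F D = r := by simpa using hD
    simpa using (le_codeSub_iff.1 hD'.1).2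

/-- Higher rank-weight enumerators of an MRD code. -/
theorem mrd_higher_weight_enumerator (n m d : ℕ) (hnm : n < m)
    (C : Submodule F (Matrix (Fin n) (Fin m) F))
    (hd1 : ∀ M ∈ C, M ≠ 0 → d ≤ M.rank)
    (hd2 : ∃ M ∈ C, M ≠ 0 ∧ M.rank = d)
    (hk : Module.finrank F C = m * (n - d + 1))
    (r : ℕ) (hr : 1 ≤ r) (hrk : r ≤ Module.finrank F C) (x y : ℚ) :
    (∑ᶠ D ∈ {D : Submodule F (Matrix (Fin n) (Fin m) F) |
        D ≤ C ∧ Module.finrank F D = r},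
        x ^ (n - Module.finrank F (Supp D)) * y ^ Module.finrank F (Supp D))
      = ∑ w ∈ Finset.Icc d n,
          gb (Fintype.card F) n w *
            (∑ u ∈ Finset.Icc d w,
              (-1 : ℚ) ^ (w - u) * (Fintype.card F : ℚ) ^ ((w - u).choose 2) *
                gb (Fintype.card F) w u *
                gbZ (Fintype.card F)
                  ((Module.finrank F C : ℤ) - (m : ℤ) * ((n : ℤ) - (u : ℤ))) r) *
            x ^ (n - w) * y ^ w := by
  classical
  have hq : (1 : ℚ) < Fintype.card F := by exact_mod_cast Fintype.one_lt_card
  have : Fintype (Submodule F (Fin n → F)) := Fintype.ofFinite _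
  have : Fintype (Submodule F (Matrix (Fin n) (Fin m) F)) := Fintype.ofFinite _
  have hd0 : 0 < d := by
    obtain ⟨M, _, hM0, rfl⟩ := hd2
    refine Nat.pos_of_ne_zero fun h => hM0 ?_
    rw [← finrank_colspace, Submodule.finrank_eq_zero] at h
    ext i j
    exact congrFun ((Submodule.mem_bot F).1 (h ▸ col_mem_colspace M j)) i
  have hdn : d ≤ n := by
    obtain ⟨M, _, _, rfl⟩ := hd2
    simpa using M.rank_le_height
  set N : ℕ → ℚ := fun u => if u < d then 0 else gb (Fintype.card F) (m * (u - d + 1)) r with hNdef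
  have hN : ∀ U : Submodule F (Fin n → F),
      gb (Fintype.card F) (Module.finrank F (codeSub C U)) r = N (Module.finrank F U) := by
    intro U
    by_cases h : Module.finrank F U < d
    · rw [codeSub_eq_bot hd1 h, finrank_bot, gb_eq_zero_of_lt _ hr, hNdef]
      simp [h]
    · rw [finrank_codeSub_of_mrd hd0 hd1 hk (not_lt.1 h), hNdef]
      simp [h]
  let φ : ℕ → ℚ := fun w => ∑ v ∈ range (w + 1), (-1 : ℚ) ^ (w - v) *
      (Fintype.card F : ℚ) ^ ((w - v).choose 2) * gb (Fintype.card F) w v * N v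
  have hsum : ∀ w, φ w = ∑ u ∈ Finset.Icc d w,
          (-1 : ℚ) ^ (w - u) * (Fintype.card F : ℚ) ^ ((w - u).choose 2) *
            gb (Fintype.card F) w u *
            gbZ (Fintype.card F)
              ((Module.finrank F C : ℤ) - (m : ℤ) * ((n : ℤ) - (u : ℤ))) r := by
    intro w
    have hsub : Finset.Icc d w ⊆ range (w + 1) := fun u hu =>
      Finset.mem_range.2 (Nat.lt_succ_of_le (Finset.mem_Icc.1 hu).2)
    rw [show φ w = _ from (Finset.sum_subset hsub ?_).symm]
    · refine Finset.sum_congr rfl fun u hu => ?_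
      have hdu := (Finset.mem_Icc.1 hu).1
      have e : (Module.finrank F C : ℤ) - (m : ℤ) * ((n : ℤ) - (u : ℤ))
          = ((m * (u - d + 1) : ℕ) : ℤ) := by
        rw [hk]
        push_cast [Nat.cast_sub hdu, Nat.cast_sub hdn]
        ring
      rw [e, gbZ_natCast _ hq]
      simp [hNdef, not_lt.2 hdu]
    · intro v hv hv'
      have : v < d := by
        rw [Finset.mem_range] at hv
        rw [Finset.mem_Icc] at hv'
        omega
      simp [hNdef, this]
  have hset : {D : Submodule F (Matrix (Fin n) (Fin m) F) | D ≤ C ∧ Module.finrank F D = r}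
      = ↑(Finset.univ.filter fun D : Submodule F (Matrix (Fin n) (Fin m) F) =>
          D ≤ C ∧ Module.finrank F D = r) := by
    ext; simp
  rw [hset, finsum_mem_coe_finset,
    ← Finset.sum_fiberwise_of_maps_to (g := Supp) (t := Finset.univ) (by simp)]
  have hfib : ∀ U : Submodule F (Fin n → F),
      ∑ D ∈ (Finset.univ.filter fun D : Submodule F (Matrix (Fin n) (Fin m) F) =>
          D ≤ C ∧ Module.finrank F D = r) with Supp D = U,
        x ^ (n - Module.finrank F (Supp D)) * y ^ Module.finrank F (Supp D)
      = φ (Module.finrank F U) *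
        (x ^ (n - Module.finrank F U) * y ^ Module.finrank F U) := by
    intro U
    rw [Finset.sum_congr rfl
      (g := fun _ => x ^ (n - Module.finrank F U) * y ^ Module.finrank F U)
      (fun D hD => by rw [(Finset.mem_filter.1 hD).2]), Finset.sum_const, nsmul_eq_mul,
      Finset.filter_filter,
      card_subcode_supp_eq hN]
  rw [Finset.sum_congr rfl fun U _ => hfib U]
  have htop := sum_submodule_le_finrank (⊤ : Submodule F (Fin n → F))
    (fun w => φ w * (x ^ (n - w) * y ^ w))
  simp only [le_top, Finset.filter_true, finrank_top, Module.finrank_fin_fun] at htop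
  rw [htop]
  have hsub : Finset.Icc d n ⊆ range (n + 1) := fun u hu =>
    Finset.mem_range.2 (Nat.lt_succ_of_le (Finset.mem_Icc.1 hu).2)
  rw [← Finset.sum_subset hsub]
  · refine Finset.sum_congr rfl fun w hw => ?_
    rw [← hsum w]
    ring
  · intro w hw hw'
    have hwd : w < d := by
      rw [Finset.mem_range] at hw
      rw [Finset.mem_Icc] at hw'
      omega
    rw [hsum w, Finset.Icc_eq_empty (not_le.2 hwd)]
    simp
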